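/- Assume the adjustment family Z satisfies history positivity: with history σ-algebras 𝓗_k := σ(Z_0 ∪ … ∪ Z_k ∪ {A_0,…,A_{k−1}}) and π^h_{a_k} := E[1_{{A_k = a_k}} | 𝓗_k], there is c > 0 with π^h_{a_k} ≥ c a.s. for every k. Define the iterated history regressions b^h_p := E[Y·1_{{A_p = a_p}} | 𝓗_p] / π^h_{a_p} and recursively b^h_k := E[b^h_{k+1}·1_{{A_k = a_k}} | 𝓗_k] / π^h_{a_k} for k = p−1,…,0. Then the g-formula and the inverse-probability-weighting formula coincide: E[b^h_0] = E[ I_{ā_p}(Ā_p)·Y / ∏_{k=0}^{p} π^h_{a_k} ]. (The equivalence of the two expressions in Definition 3.1 of a sufficient time-dependent adjustment set, stated as a purely probabilistic identity.) -/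

import Mathlib

open MeasureTheory ProbabilityTheory

noncomputable section

/-- The σ-algebra generated by a set of real-valued random variables. -/
def genSig {Ω : Type*} (S : Set (Ω → ℝ)) : MeasurableSpace Ω :=
  ⨆ f ∈ S, MeasurableSpace.comap f (inferInstance : MeasurableSpace ℝ)

/-- Indicator `1_{A = a}` of the event that the random variable `A` takes the value `a`. -/
def ind {Ω : Type*} (A : Ω → ℝ) (a : ℝ) : Ω → ℝ := fun ω => if A ω = a then 1 else 0

/-- `I_{ā_{k-1}}(Ā_{k-1}) = ∏_{j<k} 1_{A_j = a_j}` (equal to `1` when `k = 0`). -/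
def indUpto {Ω : Type*} (A : ℕ → Ω → ℝ) (a : ℕ → ℝ) (k : ℕ) : Ω → ℝ :=
  fun ω => ∏ j ∈ Finset.range k, ind (A j) (a j) ω

variable {Ω : Type*} [MeasurableSpace Ω]

/-- Propensity `π_{a_k}(Z_k) = E[1_{A_k = a_k} ∣ σ(Z_k)]`. -/
def propen (μ : Measure Ω) (A : ℕ → Ω → ℝ) (a : ℕ → ℝ) (Z : ℕ → Set (Ω → ℝ)) (k : ℕ) : Ω → ℝ :=
  μ[ind (A k) (a k) | genSig (Z k)]

/-- Cumulative weight `λ_{ā_{k-1}}(Z̄_{k-1}) = ∏_{j<k} π_{a_j}(Z_j)` (equal to `1` when `k = 0`). -/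
def cumWeight (μ : Measure Ω) (A : ℕ → Ω → ℝ) (a : ℕ → ℝ) (Z : ℕ → Set (Ω → ℝ)) (k : ℕ) :
    Ω → ℝ :=
  fun ω => ∏ j ∈ Finset.range k, propen μ A a Z j ω

/-- The adjustment family `Z` satisfies positivity: the propensities are uniformly bounded away
from `0` almost surely, for every time `k = 0, …, p`. -/
def Positivity (μ : Measure Ω) (A : ℕ → Ω → ℝ) (a : ℕ → ℝ) (Z : ℕ → Set (Ω → ℝ)) (p : ℕ) :
    Prop :=
  ∃ c : ℝ, 0 < c ∧ ∀ k ≤ p, ∀ᵐ ω ∂μ, c ≤ propen μ A a Z k ω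

/-- Auxiliary downward recursion: `bAux μ A a Y Z p n` is the iterated regression
`b_{a_{p-n}}(Z)`. -/
def bAux (μ : Measure Ω) (A : ℕ → Ω → ℝ) (a : ℕ → ℝ) (Y : Ω → ℝ) (Z : ℕ → Set (Ω → ℝ))
    (p : ℕ) : ℕ → Ω → ℝ
  | 0 => fun ω =>
      (μ[fun ω' => Y ω' * ind (A p) (a p) ω' | genSig (Z p)]) ω / propen μ A a Z p ω
  | n + 1 => fun ω =>
      (μ[fun ω' => bAux μ A a Y Z p n ω' * ind (A (p - (n + 1))) (a (p - (n + 1))) ω' |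
          genSig (Z (p - (n + 1)))]) ω / propen μ A a Z (p - (n + 1)) ω

/-- Iterated regression `b_{a_k}(Z)`, for `k = 0, …, p`. -/
def breg (μ : Measure Ω) (A : ℕ → Ω → ℝ) (a : ℕ → ℝ) (Y : Ω → ℝ) (Z : ℕ → Set (Ω → ℝ))
    (p k : ℕ) : Ω → ℝ :=
  bAux μ A a Y Z p (p - k)

/-- `b_{a_{k-1}}(Z)` with the convention `b_{a_{-1}}(Z) = E[b_{a_0}(Z)]` (a constant). -/
def bregPrev (μ : Measure Ω) (A : ℕ → Ω → ℝ) (a : ℕ → ℝ) (Y : Ω → ℝ) (Z : ℕ → Set (Ω → ℝ))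
    (p k : ℕ) : Ω → ℝ :=
  if k = 0 then fun _ => ∫ ω, breg μ A a Y Z p 0 ω ∂μ else breg μ A a Y Z p (k - 1)

/-- The influence function `ψ_a(Z)`. -/
def psi (μ : Measure Ω) (A : ℕ → Ω → ℝ) (a : ℕ → ℝ) (Y : Ω → ℝ) (Z : ℕ → Set (Ω → ℝ))
    (p : ℕ) : Ω → ℝ := fun ω =>
  indUpto A a (p + 1) ω * (Y ω - breg μ A a Y Z p p ω) / cumWeight μ A a Z (p + 1) ω +
    ∑ k ∈ Finset.range (p + 1),
      indUpto A a k ω * (breg μ A a Y Z p k ω - bregPrev μ A a Y Z p k ω) /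
        cumWeight μ A a Z k ω

end

section GFormula

variable {Ω : Type*}

lemma genSig_mono {S T : Set (Ω → ℝ)} (h : S ⊆ T) : genSig S ≤ genSig T :=
  biSup_mono h

lemma genSig_le [mΩ : MeasurableSpace Ω] {S : Set (Ω → ℝ)} (h : ∀ f ∈ S, Measurable f) :
    genSig S ≤ mΩ :=
  iSup₂_le fun f hf => (h f hf).comap_le

lemma measurable_genSig {S : Set (Ω → ℝ)} {f : Ω → ℝ} (h : f ∈ S) :
    Measurable[genSig S] f :=
  Measurable.mono (comap_measurable f)
    (le_iSup₂_of_le (f := fun f (_ : f ∈ S) =>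
      MeasurableSpace.comap f (inferInstance : MeasurableSpace ℝ)) f h le_rfl) le_rfl

lemma measurable_ind [MeasurableSpace Ω] {A : Ω → ℝ} (hA : Measurable A) (a : ℝ) :
    Measurable (ind A a) :=
  Measurable.ite (hA (measurableSet_singleton a)) measurable_const measurable_const

lemma abs_ind_le_one (A : Ω → ℝ) (a : ℝ) (ω : Ω) : |ind A a ω| ≤ 1 := by
  unfold ind
  split_ifs <;> simp

lemma MeasureTheory.Integrable.mul_ind [MeasurableSpace Ω] {μ : Measure Ω} {F A : Ω → ℝ}
    (hF : Integrable F μ) (hA : Measurable A) (a : ℝ) :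
    Integrable (fun ω => F ω * ind A a ω) μ :=
  hF.mul_bdd (c := 1) (measurable_ind hA a).aestronglyMeasurable
    (.of_forall fun ω => abs_ind_le_one A a ω)

/-- Integrating against a bounded `m`-measurable factor does not see conditioning on `m`. -/
lemma integral_mul_condExp_of_bdd [mΩ : MeasurableSpace Ω] {μ : Measure Ω} [IsFiniteMeasure μ]
    {m : MeasurableSpace Ω} (hm : m ≤ mΩ) {V G : Ω → ℝ} {C : ℝ} (hV : Measurable[m] V)
    (hVC : ∀ᵐ ω ∂μ, |V ω| ≤ C) (hG : Integrable G μ) :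
    ∫ ω, V ω * (μ[G | m]) ω ∂μ = ∫ ω, V ω * G ω ∂μ := by
  have hVG : Integrable (V * G) μ :=
    hG.bdd_mul (c := C) (hV.mono hm le_rfl).aestronglyMeasurable hVC
  calc ∫ ω, V ω * (μ[G | m]) ω ∂μ = ∫ ω, (μ[V * G | m]) ω ∂μ :=
        integral_congr_ae
          (condExp_mul_of_stronglyMeasurable_left hV.stronglyMeasurable hVG hG).symm
    _ = ∫ ω, V ω * G ω ∂μ := integral_condExp hm

variable [mΩ : MeasurableSpace Ω] {μ : Measure Ω} {A : ℕ → Ω → ℝ} {a : ℕ → ℝ}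
  {H : ℕ → Set (Ω → ℝ)} {p : ℕ}

/-- The inverse-probability weight `∏_{j<k} 1_{A_j = a_j} / π_{a_j}`. -/
noncomputable def ipWeight (μ : Measure Ω) (A : ℕ → Ω → ℝ) (a : ℕ → ℝ) (H : ℕ → Set (Ω → ℝ)) (k : ℕ) :
    Ω → ℝ :=
  fun ω => indUpto A a k ω / cumWeight μ A a H k ω

lemma ipWeight_zero (ω : Ω) : ipWeight μ A a H 0 ω = 1 := by
  simp [ipWeight, indUpto, cumWeight]

lemma ipWeight_succ (k : ℕ) (ω : Ω) :
    ipWeight μ A a H (k + 1) ω =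
      ipWeight μ A a H k ω / propen μ A a H k ω * ind (A k) (a k) ω := by
  simp only [ipWeight, indUpto, cumWeight, Finset.prod_range_succ]
  ring

lemma measurable_propen (k : ℕ) : Measurable[genSig (H k)] (propen μ A a H k) :=
  stronglyMeasurable_condExp.measurable

lemma measurable_ipWeight (hmono : Monotone H) (hAH : ∀ j k, j < k → A j ∈ H k) (k : ℕ) :
    Measurable[genSig (H k)] (ipWeight μ A a H k) := by
  refine Measurable.div
    (Finset.measurable_fun_prod _ fun j hj => ?_) (Finset.measurable_fun_prod _ fun j hj => ?_)
  · exact @measurable_ind _ (genSig (H k)) _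
      (measurable_genSig (hAH j k (Finset.mem_range.1 hj))) _
  · exact (measurable_propen j).mono
      (genSig_mono (hmono (Finset.mem_range.1 hj).le)) le_rfl

lemma abs_div_propen_le {c C : ℝ} (hc : 0 < c) {F : Ω → ℝ} {k : ℕ}
    (hF : ∀ᵐ ω ∂μ, |F ω| ≤ C) (hpos : ∀ᵐ ω ∂μ, c ≤ propen μ A a H k ω) :
    ∀ᵐ ω ∂μ, |F ω / propen μ A a H k ω| ≤ C / c := by
  filter_upwards [hF, hpos] with ω h1 h2
  rw [abs_div, abs_of_pos (hc.trans_le h2)]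
  exact div_le_div₀ ((abs_nonneg _).trans h1) h1 hc h2

lemma exists_ae_abs_ipWeight_le (hpos : Positivity μ A a H p) {k : ℕ} (hk : k ≤ p + 1) :
    ∃ C : ℝ, ∀ᵐ ω ∂μ, |ipWeight μ A a H k ω| ≤ C := by
  obtain ⟨c, hc, hcp⟩ := hpos
  induction k with
  | zero => exact ⟨1, .of_forall fun ω => by simp [ipWeight_zero]⟩
  | succ k ih =>
    obtain ⟨C, hC⟩ := ih (by lia)
    refine ⟨C / c, ?_⟩
    filter_upwards [abs_div_propen_le hc hC (hcp k (by lia))] with ω hω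
    rw [ipWeight_succ, abs_mul]
    exact (mul_le_of_le_one_right (abs_nonneg _) (abs_ind_le_one _ _ _)).trans hω

lemma integrable_condExp_div_propen (hle : ∀ k, genSig (H k) ≤ mΩ)
    (hpos : Positivity μ A a H p) {k : ℕ} (hk : k ≤ p) (G : Ω → ℝ) :
    Integrable (fun ω => (μ[G | genSig (H k)]) ω / propen μ A a H k ω) μ := by
  obtain ⟨c, hc, hcp⟩ := hpos
  simp_rw [div_eq_mul_inv]
  refine integrable_condExp.mul_bdd (c := 1 / c)
    ((measurable_propen k).mono (hle k) le_rfl).inv.aestronglyMeasurable ?_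
  filter_upwards [abs_div_propen_le (F := fun _ => 1) (C := 1) hc (.of_forall fun _ => by simp)
    (hcp k hk)] with ω hω
  simpa [div_eq_mul_inv] using hω

/-- One step of the g-formula recursion moves the weight from time `k` to time `k + 1`. -/
lemma integral_ipWeight_mul_condExp_div_propen [IsFiniteMeasure μ]
    (hA : ∀ k, Measurable (A k)) (hle : ∀ k, genSig (H k) ≤ mΩ) (hmono : Monotone H)
    (hAH : ∀ j k, j < k → A j ∈ H k) (hpos : Positivity μ A a H p) {k : ℕ} (hk : k ≤ p)
    {F : Ω → ℝ} (hF : Integrable F μ) :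
    ∫ ω, ipWeight μ A a H k ω *
        ((μ[fun ω' => F ω' * ind (A k) (a k) ω' | genSig (H k)]) ω / propen μ A a H k ω) ∂μ =
      ∫ ω, ipWeight μ A a H (k + 1) ω * F ω ∂μ := by
  obtain ⟨C, hC⟩ := exists_ae_abs_ipWeight_le hpos (k := k) (by lia)
  obtain ⟨c, hc, hcp⟩ := hpos
  have key := integral_mul_condExp_of_bdd (hle k)
    (V := fun ω => ipWeight μ A a H k ω / propen μ A a H k ω)
    ((measurable_ipWeight hmono hAH k).div (measurable_propen k))
    (abs_div_propen_le hc hC (hcp k hk)) (hF.mul_ind (hA k) (a k))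
  convert key using 3 with ω ω
  · ring
  · rw [ipWeight_succ]
    ring

lemma integrable_bAux {Y : Ω → ℝ} (hle : ∀ k, genSig (H k) ≤ mΩ)
    (hpos : Positivity μ A a H p) (n : ℕ) : Integrable (bAux μ A a Y H p n) μ := by
  cases n <;> exact integrable_condExp_div_propen hle hpos (by lia) _

lemma integral_ipWeight_mul_bAux [IsFiniteMeasure μ] {Y : Ω → ℝ} (hY : Integrable Y μ)
    (hA : ∀ k, Measurable (A k)) (hle : ∀ k, genSig (H k) ≤ mΩ) (hmono : Monotone H)
    (hAH : ∀ j k, j < k → A j ∈ H k) (hpos : Positivity μ A a H p) {n : ℕ} (hn : n ≤ p) :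
    ∫ ω, ipWeight μ A a H (p - n) ω * bAux μ A a Y H p n ω ∂μ =
      ∫ ω, ipWeight μ A a H (p + 1) ω * Y ω ∂μ := by
  induction n with
  | zero => exact integral_ipWeight_mul_condExp_div_propen hA hle hmono hAH hpos le_rfl hY
  | succ n ih =>
    rw [← ih (by lia), show p - n = p - (n + 1) + 1 by lia]
    exact integral_ipWeight_mul_condExp_div_propen hA hle hmono hAH hpos (by lia)
      (integrable_bAux hle hpos n)

end GFormula

/-- equivalence of the two expressions in Definition 3.1.  Under history
positivity for the adjustment family `Z`, the g-formula and the inverse-probability-weighting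
formula coincide: `E[b^h_0] = E[I_(ā_p)(Ā_p) ⬝ Y / ∏_(k=0)^p π^h_(a_k)]`, where the history
σ-algebras are `𝓗_k = σ(Z_0 ∪ … ∪ Z_k ∪ {A_0, …, A_(k-1)})`. -/
theorem gformula_eq_ipw {Ω : Type*} [mΩ : MeasurableSpace Ω] [StandardBorelSpace Ω]
    (P : Measure Ω) [IsProbabilityMeasure P] (p : ℕ)
    (A : ℕ → Ω → ℝ) (hA : ∀ k, Measurable (A k))
    (hAfin : ∀ k, (Set.range (A k)).Finite)
    (Y : Ω → ℝ) (hYm : Measurable Y) (hYbd : ∃ C : ℝ, ∀ ω, |Y ω| ≤ C)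
    (a : ℕ → ℝ) (ha : ∀ k ≤ p, a k ∈ Set.range (A k))
    (Z : ℕ → Set (Ω → ℝ)) (hZ : ∀ k, ∀ f ∈ Z k, Measurable f)
    (H : ℕ → Set (Ω → ℝ))
    (hH : ∀ k, H k = (⋃ j ∈ Set.Iic k, Z j) ∪ A '' Set.Iio k)
    (hHpos : Positivity P A a H p) :
    ∫ ω, breg P A a Y H p 0 ω ∂P =
      ∫ ω, indUpto A a (p + 1) ω * Y ω / cumWeight P A a H (p + 1) ω ∂P := by
  obtain ⟨C, hC⟩ := hYbd
  have hY : Integrable Y P := .of_bound hYm.aestronglyMeasurable C (.of_forall hC)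
  have hle : ∀ k, genSig (H k) ≤ mΩ := fun k => genSig_le fun f hf => by
    rw [hH] at hf
    obtain hf | ⟨j, -, rfl⟩ := hf
    · obtain ⟨j, -, hj⟩ := Set.mem_iUnion₂.1 hf
      exact hZ j f hj
    · exact hA j
  have hmono : Monotone H := fun j k hjk => by
    rw [hH, hH]
    exact Set.union_subset_union (Set.biUnion_subset_biUnion_left (Set.Iic_subset_Iic.2 hjk))
      (Set.image_mono (Set.Iio_subset_Iio hjk))
  have hAH : ∀ j k, j < k → A j ∈ H k := fun j k hjk => by
    rw [hH]
    exact .inr (Set.mem_image_of_mem A hjk)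
  have key := integral_ipWeight_mul_bAux hY hA hle hmono hAH hHpos le_rfl
  simpa [breg, ipWeight_zero, ipWeight, div_mul_eq_mul_div, indUpto, cumWeight] using key
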